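/- arXiv:1105.5499 — 2 statements merged into one kernel-verified Lean document; each statement's English description precedes it below -/
import Mathlib

section
/- Let 1 ≤ p₁ < 2 and let s > 0 satisfy 1/s > 1/2. Then there exists a constant C > 0 such that for every N ∈ ℕ, sup_{n ∈ ℕ} n^{1/s} · d_n(id : ℓ_{p₁}^N → ℓ_∞^N) ≤ C · N^{1/s − 1/2}, where d_n denotes the n-th Kolmogorov number. -/
open scoped ENNReal BigOperators

/-- The ℓ_p quasi-norm on ℝ^N, for `p : ℝ≥0∞` (with `p = ∞` giving the sup-norm). -/
noncomputable def pNorm (p : ℝ≥0∞) {N : ℕ} (x : Fin N → ℝ) : ℝ :=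
  if p = ∞ then ⨆ i, |x i| else (∑ i, |x i| ^ p.toReal) ^ (1 / p.toReal)

/-- The n-th Kolmogorov number of the identity map `id : ℓ_p^N → ℓ_q^N`. -/
noncomputable def kolmogorovNumber (p q : ℝ≥0∞) (N n : ℕ) : ℝ :=
  sInf { r : ℝ | ∃ V : Submodule ℝ (Fin N → ℝ), Module.finrank ℝ (↥V) < n ∧
    r = sSup { s : ℝ | ∃ x : Fin N → ℝ, pNorm p x ≤ 1 ∧
      s = sInf { t : ℝ | ∃ v ∈ V, t = pNorm q (x - v) } } }

/-- The n-th Gelfand number of the identity map `id : ℓ_p^N → ℓ_q^N`. -/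
noncomputable def gelfandNumber (p q : ℝ≥0∞) (N n : ℕ) : ℝ :=
  sInf { r : ℝ | ∃ M : Submodule ℝ (Fin N → ℝ), N - Module.finrank ℝ (↥M) < n ∧
    r = sSup { s : ℝ | ∃ x ∈ M, pNorm p x ≤ 1 ∧ s = pNorm q x } }

/-- The n-th approximation number of the identity map `id : ℓ_p^N → ℓ_q^N`. -/
noncomputable def approxNumber (p q : ℝ≥0∞) (N n : ℕ) : ℝ :=
  sInf { r : ℝ | ∃ L : (Fin N → ℝ) →ₗ[ℝ] (Fin N → ℝ),
    Module.finrank ℝ (↥(LinearMap.range L)) < n ∧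
    r = sSup { s : ℝ | ∃ x : Fin N → ℝ, pNorm p x ≤ 1 ∧ s = pNorm q (x - L x) } }

/-- The sign `±1` encoded by a Boolean. -/
noncomputable def boolSign (b : Bool) : ℝ := if b then 1 else -1

/-- The sum of the entries of `v` with the signs given by `r`. -/
noncomputable def signedSum {N : ℕ} (v : Fin N → ℝ) (r : Fin N → Bool) : ℝ :=
  ∑ j, boolSign (r j) * v j

lemma sum_bool_pi_succ {N : ℕ} (f : (Fin (N + 1) → Bool) → ℝ) :
    ∑ r, f r = ∑ r : Fin N → Bool,
      (f (Fin.cons true r : Fin (N + 1) → Bool) + f (Fin.cons false r : Fin (N + 1) → Bool)) := by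
  rw [← (Fin.consEquiv (fun _ : Fin (N + 1) => Bool)).sum_comp, Fintype.sum_prod_type,
    Fintype.sum_bool, ← Finset.sum_add_distrib]
  rfl

lemma signedSum_cons {N : ℕ} (v : Fin (N + 1) → ℝ) (b : Bool) (r : Fin N → Bool) :
    signedSum v (Fin.cons b r : Fin (N + 1) → Bool) =
      boolSign b * v 0 + signedSum (fun j => v j.succ) r := by
  simp [signedSum, Fin.sum_univ_succ]

lemma sum_signedSum_sq : ∀ {N : ℕ} (v : Fin N → ℝ),
    ∑ r, signedSum v r ^ 2 = 2 ^ N * ∑ j, v j ^ 2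
  | 0, v => by simp [signedSum]
  | N + 1, v => by
    have ih := sum_signedSum_sq (fun j : Fin N => v j.succ)
    rw [sum_bool_pi_succ, Fin.sum_univ_succ]
    have h : ∀ r : Fin N → Bool,
        signedSum v (Fin.cons true r : Fin (N + 1) → Bool) ^ 2 +
          signedSum v (Fin.cons false r : Fin (N + 1) → Bool) ^ 2 =
        2 * v 0 ^ 2 + 2 * signedSum (fun j => v j.succ) r ^ 2 := by
      intro r
      simp only [signedSum_cons, boolSign]
      norm_num
      ring
    simp only [h]
    rw [Finset.sum_add_distrib, ← Finset.mul_sum, ← Finset.mul_sum, ih]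
    simp
    ring

lemma sum_signedSum_pow_four_le : ∀ {N : ℕ} (v : Fin N → ℝ),
    ∑ r, signedSum v r ^ 4 ≤ 3 * 2 ^ N * (∑ j, v j ^ 2) ^ 2
  | 0, v => by simp [signedSum]
  | N + 1, v => by
    have ih := sum_signedSum_pow_four_le (fun j : Fin N => v j.succ)
    have h2 := sum_signedSum_sq (fun j : Fin N => v j.succ)
    rw [sum_bool_pi_succ, Fin.sum_univ_succ]
    have h : ∀ r : Fin N → Bool,
        signedSum v (Fin.cons true r : Fin (N + 1) → Bool) ^ 4 +
          signedSum v (Fin.cons false r : Fin (N + 1) → Bool) ^ 4 =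
        2 * v 0 ^ 4 + 12 * v 0 ^ 2 * signedSum (fun j => v j.succ) r ^ 2 +
          2 * signedSum (fun j => v j.succ) r ^ 4 := by
      intro r
      simp only [signedSum_cons, boolSign]
      norm_num
      ring
    simp only [h]
    rw [Finset.sum_add_distrib, Finset.sum_add_distrib, ← Finset.mul_sum, ← Finset.mul_sum,
      ← Finset.mul_sum, h2]
    simp only [Finset.sum_const, Finset.card_univ, Fintype.card_fun, Fintype.card_bool,
      Fintype.card_fin, nsmul_eq_mul, Nat.cast_pow, Nat.cast_ofNat]
    have : (0 : ℝ) ≤ 2 ^ N * v 0 ^ 4 := by positivity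
    rw [pow_succ (2 : ℝ) N]
    nlinarith

lemma exp_neg_abs_half_le (u : ℝ) :
    Real.exp (-(|u| / 2)) ≤ 1 - u ^ 2 / 4 + u ^ 4 / 32 := by
  rw [← sq_abs u, ← (show Even 4 by decide).pow_abs u]
  have hu : 0 ≤ |u| := abs_nonneg u
  generalize |u| = t at *
  have h1 := Real.quadratic_le_exp_of_nonneg (show 0 ≤ t / 2 by positivity)
  have h2 : Real.exp (-(t / 2)) * Real.exp (t / 2) = 1 := by rw [← Real.exp_add]; simp
  have h3 : Real.exp (-(t / 2)) ≤ 1 - t / 2 + t ^ 2 / 8 := by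
    have h4 : (1 - t / 2 + t ^ 2 / 8) * (1 + t / 2 + (t / 2) ^ 2 / 2) ≥ 1 := by
      nlinarith [pow_nonneg hu 4]
    have h5 : 0 ≤ 1 - t / 2 + t ^ 2 / 8 := by nlinarith [sq_nonneg (t - 2)]
    have h6 : Real.exp (-(t / 2)) * Real.exp (t / 2) ≤
        (1 - t / 2 + t ^ 2 / 8) * Real.exp (t / 2) := by
      rw [h2]; exact h4.trans (mul_le_mul_of_nonneg_left h1 h5)
    exact le_of_mul_le_mul_right h6 (Real.exp_pos _)
  have h7 : 0 ≤ t * (t - 2) ^ 2 * (t + 4) := by positivity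
  nlinarith

/-- A Laplace transform estimate for the modulus of a normalised Rademacher sum. -/
lemma sum_exp_neg_abs_signedSum_le {N : ℕ} (v : Fin N → ℝ) (hv : ∑ j, v j ^ 2 = 1) :
    ∑ r, Real.exp (-(|signedSum v r| / 2)) ≤ 2 ^ N * (27 / 32) := by
  refine (Finset.sum_le_sum fun r _ => exp_neg_abs_half_le (signedSum v r)).trans ?_
  have h2 := sum_signedSum_sq v
  have h4 := sum_signedSum_pow_four_le v
  rw [hv] at h2 h4
  rw [Finset.sum_add_distrib, Finset.sum_sub_distrib, ← Finset.sum_div, ← Finset.sum_div, h2]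
  simp only [Finset.sum_const, Finset.card_univ, Fintype.card_fun, Fintype.card_bool,
    Fintype.card_fin, nsmul_eq_mul, Nat.cast_pow, Nat.cast_ofNat]
  linarith

/-- Rademacher sums are subgaussian. -/
lemma sum_exp_signedSum_le {N : ℕ} (v : Fin N → ℝ) :
    ∑ r, Real.exp (signedSum v r) ≤ 2 ^ N * Real.exp ((∑ j, v j ^ 2) / 2) := by
  have h : ∑ r, Real.exp (signedSum v r) = ∏ j, (2 * Real.cosh (v j)) := by
    have h1 : ∀ j, 2 * Real.cosh (v j) = ∑ b : Bool, Real.exp (boolSign b * v j) := by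
      intro j
      rw [Real.cosh_eq, Fintype.sum_bool]
      simp [boolSign]
      ring
    simp only [h1, signedSum, Real.exp_sum]
    rw [Finset.prod_univ_sum, Fintype.piFinset_univ]
  rw [h, Finset.sum_div, Real.exp_sum, Finset.prod_mul_distrib]
  simp only [Finset.prod_const, Finset.card_univ, Fintype.card_fin]
  gcongr with j
  exact Real.cosh_le_exp_half_sq (v j)

lemma sum_prod_rows {N : ℕ} (m : ℕ) (f : Fin m → (Fin N → Bool) → ℝ) :
    ∑ A : Fin m → Fin N → Bool, ∏ i, f i (A i) = ∏ i, ∑ r, f i r := by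
  rw [Finset.prod_univ_sum, Fintype.piFinset_univ]

/-- Exponential Markov inequality for counting sign matrices. -/
lemma card_filter_le_sum_exp {α : Type*} [Fintype α] (P : α → Prop) [DecidablePred P]
    (f : α → ℝ) (h : ∀ a, P a → 0 ≤ f a) :
    ((Finset.univ.filter P).card : ℝ) ≤ ∑ a, Real.exp (f a) := by
  rw [Finset.card_eq_sum_ones, Nat.cast_sum]
  refine (Finset.sum_le_sum (g := fun a => Real.exp (f a)) fun a ha => ?_).trans
    (Finset.sum_le_sum_of_subset_of_nonneg (Finset.filter_subset _ _) fun a _ _ =>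
      (Real.exp_pos _).le)
  simpa using h a (Finset.mem_filter.1 ha).2

open Classical in
/-- Few sign matrices have a small image of a given vector in the `ℓ_1` norm. -/
lemma card_small_image_le {N : ℕ} (m : ℕ) (v : Fin N → ℝ) :
    ((Finset.univ.filter fun A : Fin m → Fin N → Bool =>
      ∑ i, |signedSum v (A i)| < m / 8 * √(∑ j, v j ^ 2)).card : ℝ) ≤
        2 ^ (N * m) * (9 / 10) ^ m := by
  by_cases hv : ∑ j, v j ^ 2 = 0
  · have : ∀ A : Fin m → Fin N → Bool,
        ¬ (∑ i, |signedSum v (A i)| < m / 8 * √(∑ j, v j ^ 2)) := by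
      intro A
      rw [hv]
      simpa using Finset.sum_nonneg fun i _ => abs_nonneg (signedSum v (A i))
    simp only [this]
    simp only [Finset.filter_false, Finset.card_empty, Nat.cast_zero]
    positivity
  have hpos : 0 < ∑ j, v j ^ 2 :=
    lt_of_le_of_ne (Finset.sum_nonneg fun j _ => sq_nonneg _) (Ne.symm hv)
  set c := √(∑ j, v j ^ 2) with hc
  have hcpos : 0 < c := Real.sqrt_pos.2 hpos
  have hc2 : c ^ 2 = ∑ j, v j ^ 2 := Real.sq_sqrt hpos.le
  have hw : ∑ j, (v j / c) ^ 2 = 1 := by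
    simp only [div_pow]
    rw [← Finset.sum_div, hc2, div_self hv]
  have hs : ∀ r, signedSum (fun j => v j / c) r = signedSum v r / c := by
    intro r
    simp only [signedSum, Finset.sum_div, mul_div_assoc]
  refine (card_filter_le_sum_exp _
    (fun A => ∑ i, (1 / 16 - |signedSum (fun j => v j / c) (A i)| / 2)) ?_).trans ?_
  · intro A hA
    simp only [hs, abs_div, abs_of_pos hcpos]
    rw [Finset.sum_sub_distrib]
    simp only [← Finset.sum_div]
    have : (∑ i, |signedSum v (A i)|) / c ≤ m / 8 := by
      rw [div_le_iff₀ hcpos]; exact hA.le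
    simp
    linarith
  · simp only [Real.exp_sum]
    rw [sum_prod_rows m (fun _ r => Real.exp (1 / 16 - |signedSum (fun j => v j / c) r| / 2))]
    rw [Finset.prod_const, Finset.card_univ, Fintype.card_fin, pow_mul, ← mul_pow]
    refine pow_le_pow_left₀ (Finset.sum_nonneg fun _ _ => (Real.exp_pos _).le) ?_ m
    have he : Real.exp (1 / 16) ≤ 16 / 15 := by
      have h1 := Real.add_one_le_exp (-(1 / 16 : ℝ))
      have h2 : Real.exp (-(1 / 16 : ℝ)) * Real.exp (1 / 16) = 1 := by rw [← Real.exp_add]; simp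
      nlinarith [Real.exp_pos (1 / 16 : ℝ)]
    simp only [sub_eq_add_neg, Real.exp_add, ← Finset.mul_sum]
    have h3 := sum_exp_neg_abs_signedSum_le _ hw
    have h4 : (0 : ℝ) < 2 ^ N := by positivity
    calc Real.exp (1 / 16) * ∑ r, Real.exp (-(|signedSum (fun j => v j / c) r| / 2))
        ≤ 16 / 15 * (2 ^ N * (27 / 32)) := by
          refine mul_le_mul he h3 (Finset.sum_nonneg fun _ _ => (Real.exp_pos _).le) (by norm_num)
      _ = _ := by ring

open Classical in
/-- Few sign matrices have a large pairing with a given sign vector and a given vector. -/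
lemma card_large_pairing_le {N : ℕ} (m : ℕ) (θ : Fin m → Bool) (v : Fin N → ℝ) {k : ℝ}
    (hk : 0 < k) (hv : ∑ j, v j ^ 2 ≤ k) :
    ((Finset.univ.filter fun A : Fin m → Fin N → Bool =>
      2 * m * √k < ∑ i, boolSign (θ i) * signedSum v (A i)).card : ℝ) ≤
        2 ^ (N * m) * Real.exp (-2) ^ m := by
  have hsk : 0 < √k := Real.sqrt_pos.2 hk
  have hs : ∀ (i : Fin m) r, signedSum (fun j => 2 / √k * boolSign (θ i) * v j) r =
      2 / √k * (boolSign (θ i) * signedSum v r) := by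
    intro i r
    simp only [signedSum, Finset.mul_sum]
    exact Finset.sum_congr rfl fun j _ => by ring
  refine (card_filter_le_sum_exp _
    (fun A => ∑ i, (-4 + signedSum (fun j => 2 / √k * boolSign (θ i) * v j) (A i))) ?_).trans ?_
  · intro A hA
    simp only [hs]
    rw [Finset.sum_add_distrib, ← Finset.mul_sum]
    have h1 : 2 / √k * (2 * m * √k) ≤ 2 / √k * ∑ i, boolSign (θ i) * signedSum v (A i) := by
      gcongr
    have h2 : 2 / √k * (2 * m * √k) = 4 * m := by field_simp; ring
    simp
    linarith
  · simp only [Real.exp_sum]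
    rw [sum_prod_rows m (fun i r =>
      Real.exp (-4 + signedSum (fun j => 2 / √k * boolSign (θ i) * v j) r)), pow_mul, ← mul_pow]
    refine (Finset.prod_le_prod (g := fun _ => 2 ^ N * Real.exp (-2))
      (fun _ _ => Finset.sum_nonneg fun _ _ => (Real.exp_pos _).le) fun i _ => ?_).trans (by simp)
    simp only [Real.exp_add, ← Finset.mul_sum]
    have h1 := sum_exp_signedSum_le (fun j => 2 / √k * boolSign (θ i) * v j)
    have h2 : ∑ j, (2 / √k * boolSign (θ i) * v j) ^ 2 ≤ 4 := by
      have hb : boolSign (θ i) ^ 2 = 1 := by cases θ i <;> simp [boolSign]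
      simp only [mul_pow, div_pow, hb, Real.sq_sqrt hk.le]
      rw [← Finset.mul_sum]
      calc _ ≤ 2 ^ 2 / k * 1 * k := by gcongr
        _ = 4 := by field_simp; norm_num
    calc Real.exp (-4) * ∑ r, Real.exp (signedSum (fun j => 2 / √k * boolSign (θ i) * v j) r)
        ≤ Real.exp (-4) * (2 ^ N * Real.exp 2) := by
          refine mul_le_mul_of_nonneg_left (h1.trans ?_) (Real.exp_pos _).le
          gcongr
          linarith
      _ = 2 ^ N * (Real.exp (-4) * Real.exp 2) := by ring
      _ = _ := by rw [← Real.exp_add]; norm_num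

lemma sum_Icc_pow_natAbs_mul (x : ℝ) (k : ℕ) :
    (∑ a ∈ Finset.Icc (-(k : ℤ)) k, x ^ a.natAbs) * (1 - x) = 1 - x + 2 * x * (1 - x ^ k) := by
  induction k with
  | zero => simp
  | succ k ih =>
    have h : Finset.Icc (-((k + 1 : ℕ) : ℤ)) ((k + 1 : ℕ) : ℤ) =
        insert ((k : ℤ) + 1) (insert (-((k : ℤ) + 1)) (Finset.Icc (-(k : ℤ)) k)) := by
      ext a
      simp only [Finset.mem_Icc, Finset.mem_insert]
      push_cast
      omega
    rw [h, Finset.sum_insert (by simp; omega), Finset.sum_insert (by simp)]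
    have h1 : ((k : ℤ) + 1).natAbs = k + 1 := by omega
    rw [Int.natAbs_neg, h1, add_mul, add_mul, ih]
    ring

/-- The integer points of the `ℓ_1` ball of radius `k`. -/
noncomputable def integerBall (N k : ℕ) : Finset (Fin N → ℤ) :=
  (Fintype.piFinset fun _ => Finset.Icc (-(k : ℤ)) k).filter fun z => ∑ j, (z j).natAbs ≤ k

lemma mem_integerBall {N k : ℕ} {z : Fin N → ℤ} :
    z ∈ integerBall N k ↔ ∑ j, (z j).natAbs ≤ k := by
  simp only [integerBall, Finset.mem_filter, Fintype.mem_piFinset, Finset.mem_Icc,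
    and_iff_right_iff_imp]
  intro h j
  have := Finset.single_le_sum (f := fun j => (z j).natAbs) (fun _ _ => Nat.zero_le _)
    (Finset.mem_univ j)
  omega

lemma card_integerBall_mul_pow_le (N k : ℕ) {x : ℝ} (hx : 0 < x) (hx2 : x ≤ 1 / 2) :
    (integerBall N k).card * x ^ k ≤ Real.exp (4 * x * N) := by
  have h1 : ∑ a ∈ Finset.Icc (-(k : ℤ)) k, x ^ a.natAbs ≤ Real.exp (4 * x) := by
    refine le_trans ?_ (Real.add_one_le_exp _)
    refine le_of_mul_le_mul_right ?_ (show 0 < 1 - x by linarith)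
    rw [sum_Icc_pow_natAbs_mul]
    nlinarith [mul_pos hx (pow_pos hx k)]
  calc ((integerBall N k).card : ℝ) * x ^ k = ∑ z ∈ integerBall N k, x ^ k := by simp
    _ ≤ ∑ z ∈ integerBall N k, ∏ j, x ^ (z j).natAbs := by
        refine Finset.sum_le_sum fun z hz => ?_
        rw [Finset.prod_pow_eq_pow_sum]
        exact pow_le_pow_of_le_one hx.le (by linarith) (mem_integerBall.1 hz)
    _ ≤ ∑ z ∈ Fintype.piFinset fun _ : Fin N => Finset.Icc (-(k : ℤ)) k,
          ∏ j, x ^ (z j).natAbs :=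
        Finset.sum_le_sum_of_subset_of_nonneg (Finset.filter_subset _ _) fun _ _ _ =>
          Finset.prod_nonneg fun _ _ => (pow_pos hx _).le
    _ = (∑ a ∈ Finset.Icc (-(k : ℤ)) k, x ^ a.natAbs) ^ N := by
        rw [Finset.sum_prod_piFinset (Finset.Icc (-(k : ℤ)) k)
          (fun (_ : Fin N) a => x ^ a.natAbs)]
        simp
    _ ≤ Real.exp (4 * x) ^ N :=
        pow_le_pow_left₀ (Finset.sum_nonneg fun _ _ => (pow_pos hx _).le) h1 N
    _ = _ := by rw [← Real.exp_nat_mul]; ring_nf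

/-- A sign matrix which is bounded below on all integer points of an `ℓ_1` ball and bounded above
on the flat ones. -/
lemma exists_sign_matrix {N k m : ℕ} (hk : 0 < k)
    (hcard : 2 * (integerBall N k).card * (9 / 10 : ℝ) ^ m < 1) :
    ∃ A : Fin m → Fin N → Bool, ∀ z ∈ integerBall N k,
      m / 8 * √(∑ j, (z j : ℝ) ^ 2) ≤ ∑ i, |signedSum (fun j => (z j : ℝ)) (A i)| ∧
      (∑ j, (z j : ℝ) ^ 2 ≤ k → ∀ θ : Fin m → Bool,
        ∑ i, boolSign (θ i) * signedSum (fun j => (z j : ℝ)) (A i) ≤ 2 * m * √k) := by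
  classical
  by_contra! hcon
  let B := integerBall N k
  let low : (Fin N → ℤ) → Finset (Fin m → Fin N → Bool) := fun z => Finset.univ.filter fun A =>
    ∑ i, |signedSum (fun j => (z j : ℝ)) (A i)| < m / 8 * √(∑ j, (z j : ℝ) ^ 2)
  let high : (Fin N → ℤ) → (Fin m → Bool) → Finset (Fin m → Fin N → Bool) := fun z θ =>
    Finset.univ.filter fun A =>
      2 * m * √(k : ℝ) < ∑ i, boolSign (θ i) * signedSum (fun j => (z j : ℝ)) (A i)
  let flat := B.filter fun z => ∑ j, (z j : ℝ) ^ 2 ≤ k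
  have hcover : (Finset.univ : Finset (Fin m → Fin N → Bool)) ⊆
      B.biUnion low ∪ flat.biUnion fun z => Finset.univ.biUnion (high z) := by
    intro A _
    obtain ⟨z, hz, h⟩ := hcon A
    rw [Finset.mem_union]
    by_cases h1 : m / 8 * √(∑ j, (z j : ℝ) ^ 2) ≤ ∑ i, |signedSum (fun j => (z j : ℝ)) (A i)|
    · right
      obtain ⟨h2, θ, h3⟩ := h h1
      simp only [Finset.mem_biUnion]
      exact ⟨z, Finset.mem_filter.2 ⟨hz, h2⟩, θ, Finset.mem_univ _,
        Finset.mem_filter.2 ⟨Finset.mem_univ _, h3⟩⟩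
    · left
      simp only [Finset.mem_biUnion]
      exact ⟨z, hz, Finset.mem_filter.2 ⟨Finset.mem_univ _, not_le.1 h1⟩⟩
  have hle := (Finset.card_le_card hcover).trans (Finset.card_union_le _ _)
  have hlow : ((B.biUnion low).card : ℝ) ≤ B.card * (2 ^ (N * m) * (9 / 10) ^ m) := by
    refine le_trans (Nat.cast_le.2 Finset.card_biUnion_le) ?_
    rw [Nat.cast_sum, ← nsmul_eq_mul]
    exact Finset.sum_le_card_nsmul _ _ _ fun z _ => card_small_image_le m _
  have hhigh : ((flat.biUnion fun z => Finset.univ.biUnion (high z)).card : ℝ) ≤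
      B.card * (2 ^ (N * m) * (9 / 10) ^ m) := by
    have h1 : ∀ z ∈ flat, ((Finset.univ.biUnion (high z)).card : ℝ) ≤
        2 ^ (N * m) * (9 / 10) ^ m := by
      intro z hz
      have h2 : ((Finset.univ.biUnion (high z)).card : ℝ) ≤
          2 ^ m * (2 ^ (N * m) * Real.exp (-2) ^ m) := by
        refine le_trans (Nat.cast_le.2 Finset.card_biUnion_le) ?_
        rw [Nat.cast_sum]
        refine (Finset.sum_le_card_nsmul _ _ _ fun θ _ => card_large_pairing_le m θ _
          (Nat.cast_pos.2 hk) (Finset.mem_filter.1 hz).2).trans ?_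
        simp
      have h3 : 2 * Real.exp (-2) ≤ 9 / 10 := by
        have h4 := Real.quadratic_le_exp_of_nonneg (show (0 : ℝ) ≤ 2 by norm_num)
        have h5 : Real.exp (-2) * Real.exp 2 = 1 := by rw [← Real.exp_add]; simp
        nlinarith [Real.exp_pos (-2)]
      calc _ ≤ _ := h2
        _ = 2 ^ (N * m) * (2 * Real.exp (-2)) ^ m := by rw [mul_pow]; ring
        _ ≤ _ := by gcongr
    refine le_trans (Nat.cast_le.2 Finset.card_biUnion_le) ?_
    rw [Nat.cast_sum]
    refine (Finset.sum_le_card_nsmul _ _ _ h1).trans ?_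
    rw [nsmul_eq_mul]
    gcongr
    exact Finset.filter_subset _ _
  have htot : ((Finset.univ : Finset (Fin m → Fin N → Bool)).card : ℝ) = 2 ^ (N * m) := by
    simp [pow_mul]
  have hle' : (2 : ℝ) ^ (N * m) ≤ 2 ^ (N * m) * (2 * B.card * (9 / 10 : ℝ) ^ m) := by
    rw [← htot]
    refine (Nat.cast_le.2 hle).trans ?_
    rw [htot]
    push_cast
    linarith
  have : (0 : ℝ) < 2 ^ (N * m) := by positivity
  nlinarith

/-- A linear functional on the intersection of the unit cube with the `ℓ_1` ball of radius `k` is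
bounded by the sum of its `k` largest coefficients. -/
lemma exists_card_eq_and_sum_mul_le {N k : ℕ} (hkN : k ≤ N) (g w : Fin N → ℝ)
    (hw1 : ∀ j, |w j| ≤ 1) (hw : ∑ j, |w j| ≤ k) :
    ∃ T : Finset (Fin N), T.card = k ∧ ∑ j, g j * w j ≤ ∑ j ∈ T, |g j| := by
  classical
  obtain ⟨T, hT, hmax⟩ := Finset.exists_max_image (Finset.powersetCard k (Finset.univ))
    (fun T : Finset (Fin N) => ∑ j ∈ T, |g j|)
    (Finset.powersetCard_nonempty.2 (by simpa using hkN))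
  have hTk : T.card = k := (Finset.mem_powersetCard.1 hT).2
  refine ⟨T, hTk, ?_⟩
  rcases T.eq_empty_or_nonempty with rfl | hne
  · have hk0 : k = 0 := by simpa using hTk.symm
    subst hk0
    have hz : ∀ j, w j = 0 := fun j => by
      have := (Finset.single_le_sum (f := fun j => |w j|) (fun _ _ => abs_nonneg _)
        (Finset.mem_univ j)).trans hw
      simpa using this
    simp [hz]
  obtain ⟨i, hi, hmin⟩ := Finset.exists_min_image T (fun j => |g j|) hne
  have hout : ∀ j ∉ T, |g j| ≤ |g i| := by
    intro j hj
    have hj' : j ∉ T.erase i := fun h => hj (Finset.mem_of_mem_erase h)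
    have h1 := hmax (insert j (T.erase i)) (Finset.mem_powersetCard.2
      ⟨Finset.subset_univ _, by
        rw [Finset.card_insert_of_notMem hj', Finset.card_erase_of_mem hi,
          Nat.sub_add_cancel (Finset.card_pos.2 hne), hTk]⟩)
    rw [Finset.sum_insert hj'] at h1
    have h2 := Finset.add_sum_erase T (fun j => |g j|) hi
    simp only at h1 h2
    linarith
  have hpt : ∀ j, g j * w j ≤ |g i| * |w j| + if j ∈ T then |g j| - |g i| else 0 := by
    intro j
    have h0 : g j * w j ≤ |g j| * |w j| := by rw [← abs_mul]; exact le_abs_self _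
    split_ifs with hj
    · nlinarith [hmin j hj, hw1 j]
    · nlinarith [hout j hj, abs_nonneg (w j)]
  calc ∑ j, g j * w j ≤ ∑ j, (|g i| * |w j| + if j ∈ T then |g j| - |g i| else 0) :=
        Finset.sum_le_sum fun j _ => hpt j
    _ = |g i| * ∑ j, |w j| + (∑ j ∈ T, |g j| - k * |g i|) := by
        rw [Finset.sum_add_distrib, ← Finset.mul_sum, Finset.sum_ite_mem, Finset.univ_inter,
          Finset.sum_sub_distrib, Finset.sum_const, hTk, nsmul_eq_mul]
    _ ≤ _ := by nlinarith [abs_nonneg (g i)]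

lemma signedSum_add {N : ℕ} (v w : Fin N → ℝ) (r : Fin N → Bool) :
    signedSum (fun j => v j + w j) r = signedSum v r + signedSum w r := by
  simp [signedSum, mul_add, Finset.sum_add_distrib]

lemma exists_int_near (u : ℝ) :
    ∃ z : ℤ, (z.natAbs : ℝ) ≤ |u| ∧ |u - z| ≤ 1 ∧ |u - z| ≤ |u| := by
  rcases le_total 0 u with hu | hu
  · refine ⟨⌊u⌋, ?_⟩
    have h1 : (0 : ℝ) ≤ ⌊u⌋ := by exact_mod_cast Int.floor_nonneg.2 hu
    have h2 := Int.floor_le u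
    have h3 := Int.lt_floor_add_one u
    rw [Nat.cast_natAbs, Int.cast_abs, abs_of_nonneg h1, abs_of_nonneg hu,
      abs_of_nonneg (by linarith)]
    exact ⟨h2, by linarith, by linarith⟩
  · refine ⟨⌈u⌉, ?_⟩
    have h1 : (⌈u⌉ : ℝ) ≤ 0 := by exact_mod_cast Int.ceil_le.2 (by simpa using hu)
    have h2 := Int.le_ceil u
    have h3 := Int.ceil_lt_add_one u
    rw [Nat.cast_natAbs, Int.cast_abs, abs_of_nonpos h1, abs_of_nonpos hu,
      abs_of_nonpos (by linarith)]
    exact ⟨by linarith, by linarith, by linarith⟩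

/-- If the integer points of the `ℓ_1` ball of radius `k` are few, then some sign matrix has a
kernel on which the `ℓ_2` norm is `O(k^{-1/2})` times the `ℓ_1` norm. -/
lemma exists_sign_matrix_ker {N k m : ℕ} (hk : 0 < k) (hkN : k ≤ N) (hm : 0 < m)
    (hcard : 2 * (integerBall N k).card * (9 / 10 : ℝ) ^ m < 1) :
    ∃ A : Fin m → Fin N → Bool, ∀ y : Fin N → ℝ, (∀ i, signedSum y (A i) = 0) →
      ∑ j, |y j| ≤ 1 → ∑ j, y j ^ 2 ≤ 514 / k := by
  classical
  obtain ⟨A, hA⟩ := exists_sign_matrix hk hcard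
  refine ⟨A, fun y hy hy1 => ?_⟩
  have hk' : (0 : ℝ) < k := Nat.cast_pos.2 hk
  have hm' : (0 : ℝ) < m := Nat.cast_pos.2 hm
  choose z hz1 hz2 hz3 using fun j => exists_int_near (k * y j)
  set w : Fin N → ℝ := fun j => k * y j - z j with hwdef
  have hsum : ∑ j, |k * y j| ≤ k := by
    simp only [abs_mul, abs_of_pos hk', ← Finset.mul_sum]
    nlinarith
  have hzB : z ∈ integerBall N k := by
    rw [mem_integerBall]
    have : ((∑ j, (z j).natAbs : ℕ) : ℝ) ≤ k := by
      push_cast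
      refine le_trans (Finset.sum_le_sum fun j _ => ?_) hsum
      simpa using hz1 j
    exact_mod_cast this
  have hw : ∑ j, |w j| ≤ k := (Finset.sum_le_sum fun j _ => hz3 j).trans hsum
  have hzw : ∀ i, signedSum (fun j => (z j : ℝ)) (A i) = - signedSum w (A i) := by
    intro i
    have h1 := signedSum_add (fun j => (z j : ℝ)) w (A i)
    have h2 : signedSum (fun j => (z j : ℝ) + w j) (A i) = k * signedSum y (A i) := by
      simp only [signedSum, Finset.mul_sum, hwdef]
      exact Finset.sum_congr rfl fun j _ => by ring
    rw [hy i] at h2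
    linarith
  -- the norming signs of the image of `w`
  let θ : Fin m → Bool := fun i => decide (0 ≤ signedSum w (A i))
  have hθ : ∀ i, |signedSum w (A i)| = boolSign (θ i) * signedSum w (A i) := by
    intro i
    by_cases h : 0 ≤ signedSum w (A i)
    · simp [θ, boolSign, h, abs_of_nonneg h]
    · simp [θ, boolSign, h, abs_of_neg (not_le.1 h)]
  let g : Fin N → ℝ := fun j => ∑ i, boolSign (θ i) * boolSign (A i j)
  have hg : ∀ v : Fin N → ℝ, ∑ i, boolSign (θ i) * signedSum v (A i) = ∑ j, g j * v j := by
    intro v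
    simp only [g, signedSum, Finset.mul_sum, Finset.sum_mul]
    rw [Finset.sum_comm]
    exact Finset.sum_congr rfl fun _ _ => Finset.sum_congr rfl fun _ _ => by ring
  obtain ⟨T, hT, hTg⟩ := exists_card_eq_and_sum_mul_le hkN g w hz2 hw
  let σ : Fin N → ℤ := fun j => if j ∈ T then (if 0 ≤ g j then 1 else -1) else 0
  have hσabs : ∀ j, (σ j).natAbs = if j ∈ T then 1 else 0 := by
    intro j
    by_cases h1 : j ∈ T <;> by_cases h2 : 0 ≤ g j <;> simp [σ, h1, h2]
  have hσB : σ ∈ integerBall N k := by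
    rw [mem_integerBall]
    simp [hσabs, hT]
  have hσ2 : ∑ j, (σ j : ℝ) ^ 2 ≤ k := by
    have : ∀ j, (σ j : ℝ) ^ 2 = if j ∈ T then 1 else 0 := by
      intro j
      by_cases h1 : j ∈ T <;> by_cases h2 : 0 ≤ g j <;> simp [σ, h1, h2]
    simp [this, hT]
  have hσg : ∑ j, g j * (σ j : ℝ) = ∑ j ∈ T, |g j| := by
    have : ∀ j, g j * (σ j : ℝ) = if j ∈ T then |g j| else 0 := by
      intro j
      by_cases h1 : j ∈ T <;> by_cases h2 : 0 ≤ g j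
      · simp [σ, h1, h2, abs_of_nonneg h2]
      · simp [σ, h1, h2, abs_of_neg (not_le.1 h2)]
      · simp [σ, h1]
      · simp [σ, h1]
    simp [this]
  have hup := (hA σ hσB).2 hσ2 θ
  have hlow := (hA z hzB).1
  simp only [hzw, abs_neg, hθ] at hlow
  rw [hg] at hlow hup
  rw [hσg] at hup
  have hsq : √(∑ j, (z j : ℝ) ^ 2) ≤ 16 * √k := by
    have : (m : ℝ) * √(∑ j, (z j : ℝ) ^ 2) ≤ m * (16 * √k) := by linarith
    exact le_of_mul_le_mul_left this hm'
  have hz256 : ∑ j, (z j : ℝ) ^ 2 ≤ 256 * k := by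
    have h1 := Real.sq_sqrt (Finset.sum_nonneg fun j (_ : j ∈ Finset.univ) => sq_nonneg (z j : ℝ))
    have h2 := Real.sq_sqrt hk'.le
    nlinarith [Real.sqrt_nonneg (∑ j, (z j : ℝ) ^ 2), Real.sqrt_nonneg (k : ℝ)]
  have hwk : ∑ j, w j ^ 2 ≤ k := by
    refine (Finset.sum_le_sum fun j _ => ?_).trans hw
    rw [← sq_abs]
    nlinarith [hz2 j, abs_nonneg (w j)]
  have hky : (k : ℝ) ^ 2 * ∑ j, y j ^ 2 ≤ 514 * k := by
    calc (k : ℝ) ^ 2 * ∑ j, y j ^ 2 ≤ ∑ j, (2 * (z j : ℝ) ^ 2 + 2 * w j ^ 2) := by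
          rw [Finset.mul_sum]
          refine Finset.sum_le_sum fun j _ => ?_
          have : (k : ℝ) * y j = z j + w j := by simp [hwdef]
          rw [← mul_pow, this]
          nlinarith [sq_nonneg ((z j : ℝ) - w j)]
      _ = 2 * ∑ j, (z j : ℝ) ^ 2 + 2 * ∑ j, w j ^ 2 := by
          rw [Finset.sum_add_distrib, Finset.mul_sum, Finset.mul_sum]
      _ ≤ _ := by linarith
  rw [le_div_iff₀ hk']
  have h5 : (k : ℝ) * ((∑ j, y j ^ 2) * k) ≤ k * 514 := by linarith
  exact le_of_mul_le_mul_left h5 hk'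

/-- The distance in `ℓ_∞^N` to a subspace, estimated by duality. -/
lemma sInf_pNorm_top_sub_le {N : ℕ} (V : Submodule ℝ (Fin N → ℝ)) (x : Fin N → ℝ) {R : ℝ}
    (h : ∀ y : Fin N → ℝ, (∀ v ∈ V, ∑ j, y j * v j = 0) → ∑ j, |y j| ≤ 1 →
      ∑ j, y j * x j ≤ R) :
    sInf {t : ℝ | ∃ v ∈ V, t = pNorm ∞ (x - v)} ≤ R := by
  have hpn : ∀ z : Fin N → ℝ, 0 ≤ pNorm ∞ z ∧ pNorm ∞ z ≤ ‖z‖ := by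
    intro z
    simp only [pNorm, if_true]
    exact ⟨Real.iSup_nonneg fun i => abs_nonneg _,
      Real.iSup_le (fun i => norm_le_pi_norm z i) (norm_nonneg z)⟩
  obtain ⟨f, hf, hfx⟩ := exists_dual_vector'' ℝ (V.mkQ x)
  have hnorm : ‖V.mkQ x‖ ≤ R := by
    have hrep : ∀ z : Fin N → ℝ, ∑ j, f (V.mkQ (Pi.single j 1)) * z j = f (V.mkQ z) := by
      intro z
      conv_rhs => rw [pi_eq_sum_univ' z]
      simp [map_sum, mul_comm]
    have h1 := h (fun j => f (V.mkQ (Pi.single j 1))) (fun v hv => by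
      rw [hrep, (Submodule.Quotient.mk_eq_zero V).2 hv |> fun e => (show V.mkQ v = 0 from e)]
      simp) ?_
    · rw [hrep, hfx] at h1
      exact h1
    · let e : Fin N → ℝ := fun j => SignType.sign (f (V.mkQ (Pi.single j 1)))
      have h2 : ∑ j, |f (V.mkQ (Pi.single j 1))| = f (V.mkQ e) := by
        rw [← hrep]
        exact Finset.sum_congr rfl fun j _ => (self_mul_sign _).symm
      have he : ‖e‖ ≤ 1 := by
        refine (pi_norm_le_iff_of_nonneg zero_le_one).2 fun j => ?_
        simp only [e, Real.norm_eq_abs]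
        generalize SignType.sign (f (V.mkQ (Pi.single j 1))) = t
        cases t <;> simp
      rw [h2]
      calc f (V.mkQ e) ≤ ‖f (V.mkQ e)‖ := Real.le_norm_self _
        _ ≤ ‖f‖ * ‖V.mkQ e‖ := f.le_opNorm _
        _ ≤ 1 * 1 := by
            gcongr
            exact (Submodule.Quotient.norm_mk_le (S := V) e).trans he
        _ = 1 := one_mul 1
  refine le_of_forall_pos_le_add fun ε hε => ?_
  obtain ⟨u, hu, hlt⟩ := Submodule.Quotient.norm_mk_lt (S := V) (V.mkQ x) hε
  have hmem : x - u ∈ V := by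
    rw [← Submodule.Quotient.mk_eq_zero V, Submodule.Quotient.mk_sub, hu]
    simp
  have hle : sInf {t : ℝ | ∃ v ∈ V, t = pNorm ∞ (x - v)} ≤ pNorm ∞ (x - (x - u)) :=
    csInf_le ⟨0, by rintro _ ⟨v, _, rfl⟩; exact (hpn _).1⟩ ⟨_, hmem, rfl⟩
  rw [sub_sub_cancel] at hle
  linarith [(hpn u).2]

lemma sum_sq_le_one_of_pNorm_le_one {N : ℕ} {p : ℝ} (hp1 : 1 ≤ p) (hp2 : p < 2)
    {x : Fin N → ℝ} (hx : pNorm (ENNReal.ofReal p) x ≤ 1) : ∑ j, x j ^ 2 ≤ 1 := by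
  rw [pNorm, if_neg ENNReal.ofReal_ne_top, ENNReal.toReal_ofReal (by linarith)] at hx
  have h1 : ∑ j, |x j| ^ p ≤ 1 := by
    by_contra! h
    exact absurd hx (not_le.2 (Real.one_lt_rpow h (by positivity)))
  refine (Finset.sum_le_sum fun j _ => ?_).trans h1
  have h2 : |x j| ^ p ≤ 1 := (Finset.single_le_sum (f := fun j => |x j| ^ p)
    (fun _ _ => by positivity) (Finset.mem_univ j)).trans h1
  have h3 : |x j| ≤ 1 := by
    by_contra! h
    exact absurd h2 (not_le.2 (Real.one_lt_rpow h (by linarith)))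
  rcases (abs_nonneg (x j)).eq_or_lt with h4 | h4
  · have : x j = 0 := abs_eq_zero.1 h4.symm
    rw [this]
    simp only [ne_eq, OfNat.ofNat_ne_zero, not_false_eq_true, zero_pow]
    positivity
  · rw [← sq_abs, ← Real.rpow_natCast]
    exact Real.rpow_le_rpow_of_exponent_ge h4 h3 (by push_cast; linarith)

/-- Upper bound for the Kolmogorov numbers in terms of the annihilator of a subspace. -/
lemma kolmogorovNumber_le_of_annihilator {N n : ℕ} {p : ℝ} (hp1 : 1 ≤ p) (hp2 : p < 2)
    (V : Submodule ℝ (Fin N → ℝ)) (hV : Module.finrank ℝ V < n) {K : ℝ}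
    (h : ∀ y : Fin N → ℝ, (∀ v ∈ V, ∑ j, y j * v j = 0) → ∑ j, |y j| ≤ 1 →
      ∑ j, y j ^ 2 ≤ K) :
    kolmogorovNumber (ENNReal.ofReal p) ∞ N n ≤ √K := by
  refine le_trans (csInf_le ⟨0, ?_⟩ ⟨V, hV, rfl⟩) ?_
  · rintro _ ⟨W, _, rfl⟩
    refine Real.sSup_nonneg ?_
    rintro _ ⟨x, _, rfl⟩
    refine Real.sInf_nonneg ?_
    rintro _ ⟨v, _, rfl⟩
    simp only [pNorm, if_true]
    exact Real.iSup_nonneg fun i => abs_nonneg _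
  · refine Real.sSup_le ?_ (Real.sqrt_nonneg K)
    rintro _ ⟨x, hx, rfl⟩
    refine sInf_pNorm_top_sub_le V x fun y hy hy1 => Real.le_sqrt_of_sq_le ?_
    have h1 := sum_sq_le_one_of_pNorm_le_one hp1 hp2 hx
    have h2 := Finset.sum_mul_sq_le_sq_mul_sq Finset.univ y x
    have h3 := h y hy hy1
    have h4 : 0 ≤ ∑ j, y j ^ 2 := Finset.sum_nonneg fun j _ => sq_nonneg _
    nlinarith

lemma kolmogorovNumber_le_one {N n : ℕ} {p : ℝ} (hp1 : 1 ≤ p) (hp2 : p < 2) (hn : 1 ≤ n) :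
    kolmogorovNumber (ENNReal.ofReal p) ∞ N n ≤ 1 := by
  refine (kolmogorovNumber_le_of_annihilator hp1 hp2 ⊥ (by rw [finrank_bot]; omega) (K := 1)
    fun y _ hy => ?_).trans (by simp)
  refine (Finset.sum_le_sum fun j _ => ?_).trans hy
  have h1 := (Finset.single_le_sum (f := fun j => |y j|) (fun _ _ => abs_nonneg _)
    (Finset.mem_univ j)).trans hy
  rw [← sq_abs]
  nlinarith [abs_nonneg (y j)]

lemma kolmogorovNumber_nonpos_of_lt {N n : ℕ} {p : ℝ} (hp1 : 1 ≤ p) (hp2 : p < 2) (hn : N < n) :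
    kolmogorovNumber (ENNReal.ofReal p) ∞ N n ≤ 0 := by
  refine (kolmogorovNumber_le_of_annihilator hp1 hp2 ⊤ (by simpa using hn) (K := 0)
    fun y hy _ => ?_).trans (by simp)
  simpa [sq] using (hy y trivial).le

/-- The Kashin–Garnaev–Gluskin bound, with unspecified constants. -/
lemma kolmogorovNumber_le_sqrt_log {N n : ℕ} {p : ℝ} (hp1 : 1 ≤ p) (hp2 : p < 2) (hn : 1 ≤ n)
    (hnN : n ≤ N) :
    kolmogorovNumber (ENNReal.ofReal p) ∞ N n ≤ √(82240 * (Real.log (320 * (N / n)) / n)) := by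
  have hn' : (0 : ℝ) < n := by exact_mod_cast hn
  have hnN' : (n : ℝ) ≤ N := by exact_mod_cast hnN
  have hN : (0 : ℝ) < N := hn'.trans_le hnN'
  set L := Real.log (320 * (N / n)) with hL
  have hL1 : 1 ≤ L := by
    rw [hL, Real.le_log_iff_exp_le (by positivity)]
    have h1 : (1 : ℝ) ≤ N / n := by rwa [le_div_iff₀ hn', one_mul]
    linarith [Real.exp_one_lt_d9]
  rcases lt_or_ge (n : ℝ) (80 * L) with hsmall | hbig
  · refine (kolmogorovNumber_le_one hp1 hp2 hn).trans (Real.le_sqrt_of_sq_le ?_)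
    rw [mul_div_assoc', le_div_iff₀ hn']
    linarith
  have hn80 : 80 ≤ n := by
    have : (80 : ℝ) ≤ n := by linarith
    exact_mod_cast this
  obtain ⟨m, rfl⟩ : ∃ m, n = m + 1 := ⟨n - 1, by omega⟩
  have hm : 0 < m := by omega
  have hm' : (0 : ℝ) < m := by exact_mod_cast hm
  have hmn : ((m + 1 : ℕ) : ℝ) ≤ 2 * m := by
    have : (1 : ℝ) ≤ m := by exact_mod_cast hm
    push_cast
    linarith
  have hmN : (m : ℝ) ≤ N := by push_cast at hnN'; linarith
  set k := ⌊m / (40 * L)⌋₊ with hkdef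
  have hkle : k ≤ m / (40 * L) := Nat.floor_le (by positivity)
  have hklt : m / (40 * L) < k + 1 := Nat.lt_floor_add_one _
  have hk : 0 < k := Nat.floor_pos.2 <| by
    rw [le_div_iff₀ (by positivity)]
    linarith
  have hk1 : (1 : ℝ) ≤ k := by exact_mod_cast hk
  have hkL : (k : ℝ) * L ≤ m / 40 := by
    rw [le_div_iff₀ (by positivity)] at hkle
    linarith
  have hkN : k ≤ N := by
    have : (k : ℝ) ≤ N := by nlinarith
    exact_mod_cast this
  have hcard : 2 * (integerBall N k).card * (9 / 10 : ℝ) ^ m < 1 := by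
    let x : ℝ := m / (160 * N)
    have hx : 0 < x := by positivity
    have hx2 : x ≤ 1 / 2 := by
      simp only [x]
      rw [div_le_iff₀ (by positivity)]
      linarith
    have h1 := card_integerBall_mul_pow_le N k hx hx2
    have h2 : Real.exp (-L) ≤ x := by
      rw [hL, Real.exp_neg, Real.exp_log (by positivity), inv_le_comm₀ (by positivity) hx]
      simp only [x, inv_div]
      rw [mul_div_assoc', div_le_div_iff₀ hm' hn']
      nlinarith
    have h3 : Real.exp (-(m / 40)) ≤ x ^ k := by
      refine le_trans ?_ (pow_le_pow_left₀ (Real.exp_pos _).le h2 k)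
      rw [← Real.exp_nat_mul]
      exact Real.exp_le_exp.2 (by linarith)
    have h4 : 4 * x * N = m / 40 := by simp only [x]; field_simp; norm_num
    rw [h4] at h1
    have h5 : ((integerBall N k).card : ℝ) ≤ Real.exp (1 / 20) ^ m := by
      have h6 := (mul_le_mul_of_nonneg_left h3 (Nat.cast_nonneg (integerBall N k).card)).trans h1
      rw [Real.exp_neg, ← div_eq_mul_inv, div_le_iff₀ (Real.exp_pos _), ← Real.exp_add] at h6
      rw [← Real.exp_nat_mul]
      exact h6.trans (Real.exp_le_exp.2 (by linarith))
    have he : Real.exp (1 / 20) ≤ 20 / 19 := by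
      have h1 := Real.add_one_le_exp (-(1 / 20 : ℝ))
      have h2 : Real.exp (-(1 / 20 : ℝ)) * Real.exp (1 / 20) = 1 := by rw [← Real.exp_add]; simp
      nlinarith [Real.exp_pos (1 / 20 : ℝ)]
    calc 2 * (integerBall N k).card * (9 / 10 : ℝ) ^ m
        ≤ 2 * (20 / 19) ^ m * (9 / 10 : ℝ) ^ m := by
          gcongr
          exact h5.trans (by gcongr)
      _ = 2 * (18 / 19) ^ m := by
          rw [mul_assoc, ← mul_pow]
          norm_num
      _ ≤ 2 * (18 / 19) ^ 40 := by
          gcongr 2 * ?_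
          exact pow_le_pow_of_le_one (by norm_num) (by norm_num) (by omega)
      _ < 1 := by norm_num
  obtain ⟨A, hA⟩ := exists_sign_matrix_ker hk hkN hm hcard
  let row : Fin m → Fin N → ℝ := fun i j => boolSign (A i j)
  refine (kolmogorovNumber_le_of_annihilator hp1 hp2 (Submodule.span ℝ (Set.range row)) ?_
    (K := 514 / k) fun y hy hy1 => hA y (fun i => ?_) hy1).trans
    (Real.sqrt_le_sqrt ?_)
  · have := finrank_range_le_card (R := ℝ) row
    rw [Fintype.card_fin] at this
    exact Nat.lt_succ_of_le this
  · have := hy (row i) (Submodule.subset_span ⟨i, rfl⟩)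
    rw [← this]
    exact Finset.sum_congr rfl fun j _ => mul_comm _ _
  · rw [div_lt_iff₀ (by positivity)] at hklt
    rw [mul_div_assoc', div_le_div_iff₀ (by positivity) hn']
    nlinarith

/-- For `1 ≤ p₁ < 2` and `1/s > 1/2` there is `C > 0` with
`sup_n n^{1/s}·d_n(id : ℓ_{p₁}^N → ℓ_∞^N) ≤ C·N^{1/s - 1/2}` for every `N`. -/
theorem kolmogorov_ideal_norm_small_p (p₁ s : ℝ) (hp1 : 1 ≤ p₁) (hp2 : p₁ < 2)
    (hs : 0 < s) (hs2 : 1/2 < 1/s) :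
    ∃ C : ℝ, 0 < C ∧ ∀ N n : ℕ, 1 ≤ n →
      (n : ℝ) ^ (1/s) * kolmogorovNumber (ENNReal.ofReal p₁) ∞ N n ≤
        C * (N : ℝ) ^ (1/s - 1/2) := by
  set δ := 1 / s - 1 / 2 with hδ
  have hδ0 : 0 < δ := by linarith
  refine ⟨√(82240 / (2 * δ)) * 320 ^ δ, by positivity, fun N n hn => ?_⟩
  have hn' : (0 : ℝ) < n := by exact_mod_cast hn
  rcases lt_or_ge N n with hNn | hnN
  · exact (mul_nonpos_of_nonneg_of_nonpos (by positivity)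
      (kolmogorovNumber_nonpos_of_lt hp1 hp2 hNn)).trans (by positivity)
  have hq : (0 : ℝ) ≤ 320 * (N / n) := by positivity
  have hlog : 82240 * (Real.log (320 * (N / n)) / n) ≤
      82240 / (2 * δ) * (((320 * (N / n) : ℝ) ^ δ) ^ 2 / n) := by
    have h1 := Real.log_le_rpow_div hq (show 0 < 2 * δ by linarith)
    rw [mul_comm 2 δ, Real.rpow_mul hq, Real.rpow_two] at h1
    calc _ ≤ 82240 * (((320 * (N / n) : ℝ) ^ δ) ^ 2 / (δ * 2) / n) := by gcongr
      _ = _ := by field_simp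
  have hd := (kolmogorovNumber_le_sqrt_log hp1 hp2 hn hnN).trans (Real.sqrt_le_sqrt hlog)
  rw [Real.sqrt_mul (by positivity), Real.sqrt_div (sq_nonneg ((320 * (N / n) : ℝ) ^ δ)),
    Real.sqrt_sq (by positivity)] at hd
  have hsplit : (n : ℝ) ^ (1 / s) = n ^ δ * √n := by
    rw [Real.sqrt_eq_rpow, ← Real.rpow_add hn', hδ]
    ring_nf
  have hpow : (n : ℝ) ^ δ * (320 * (N / n) : ℝ) ^ δ = 320 ^ δ * (N : ℝ) ^ δ := by
    rw [← Real.mul_rpow hn'.le hq, ← Real.mul_rpow (by norm_num) (Nat.cast_nonneg N)]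
    congr 1
    field_simp
  have hsn : 0 < √(n : ℝ) := Real.sqrt_pos.2 hn'
  calc _ ≤ (n : ℝ) ^ (1 / s) *
        (√(82240 / (2 * δ)) * ((320 * (N / n) : ℝ) ^ δ / √n)) := by gcongr
    _ = √(82240 / (2 * δ)) * ((n : ℝ) ^ δ * (320 * (N / n) : ℝ) ^ δ) := by
        rw [hsplit]
        field_simp
    _ = _ := by rw [hpow]; ring
end

section
/- Let 0 < p₁ ≤ 1, 2 < p₂ ≤ ∞, and let s > 0 satisfy 1/s > 1/p₁ − 1/2. Then there exists a constant C > 0 such that for every N ∈ ℕ, sup_{n ∈ ℕ} n^{1/s} · c_n(id : ℓ_{p₁}^N → ℓ_{p₂}^N) ≤ C · N^{1/s − (1/p₁ − 1/2)}, where c_n denotes the n-th Gelfand number. -/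
open scoped ENNReal BigOperators

theorem expect_iSup_sub_abs_le {X ι : Type*} [Fintype X] [Nonempty X] [Finite ι] [Nonempty ι]
    (f : X → ι → ℝ) (σ : X ≃ X) (hσ : ∀ a t, f (σ a) t = -f a t) (G : ι → ℝ) :
    𝔼 a, ⨆ t, (G t + ((𝔼 b, |f b t|) - |f a t|)) ≤ 𝔼 a, ⨆ t, (G t + 2 * f a t) := by
  set P : X → ℝ := fun a => ⨆ t, (G t + 2 * |f a t|) with hP
  set M : X → ℝ := fun a => ⨆ t, (G t - 2 * |f a t|) with hM
  set R : X → ℝ := fun a => ⨆ t, (G t + 2 * f a t) with hR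
  have leP : ∀ a t, G t + 2 * |f a t| ≤ P a := fun a t =>
    le_ciSup (f := fun t => G t + 2 * |f a t|) (Set.finite_range _).bddAbove t
  have leM : ∀ a t, G t - 2 * |f a t| ≤ M a := fun a t =>
    le_ciSup (f := fun t => G t - 2 * |f a t|) (Set.finite_range _).bddAbove t
  have leR : ∀ a t, G t + 2 * f a t ≤ R a := fun a t =>
    le_ciSup (f := fun t => G t + 2 * f a t) (Set.finite_range _).bddAbove t
  have split : ∀ a, ⨆ t, (G t + ((𝔼 b, |f b t|) - |f a t|)) ≤ (𝔼 b, P b) / 2 + M a / 2 := by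
    intro a
    refine ciSup_le fun t => ?_
    have h : G t + 2 * (𝔼 b, |f b t|) ≤ 𝔼 b, P b := by
      calc G t + 2 * (𝔼 b, |f b t|) = 𝔼 b, (G t + 2 * |f b t|) := by
            rw [Finset.expect_add_distrib, Fintype.expect_const, Finset.mul_expect]
        _ ≤ _ := Finset.expect_le_expect fun b _ => leP b t
    linarith [leM a t]
  have contract : ∀ a, P a + M a ≤ R a + R (σ a) := by
    intro a
    rw [← le_sub_iff_add_le]
    refine ciSup_le fun t => ?_
    rw [le_sub_comm]
    refine ciSup_le fun u => ?_
    have h1 := leR a t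
    have h2 := leR (σ a) t
    have h3 := leR a u
    have h4 := leR (σ a) u
    rw [hσ] at h2 h4
    rcases abs_cases (f a t) with ⟨h, _⟩ | ⟨h, _⟩ <;>
      linarith [le_abs_self (f a u), neg_abs_le (f a u)]
  have hσR : 𝔼 a, R (σ a) = 𝔼 a, R a := Fintype.expect_equiv σ _ _ fun _ => rfl
  calc _ ≤ 𝔼 a, ((𝔼 b, P b) / 2 + M a / 2) := Finset.expect_le_expect fun a _ => split a
    _ = (𝔼 a, (P a + M a)) / 2 := by
        rw [Finset.expect_add_distrib, Fintype.expect_const, ← Finset.expect_div,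
          Finset.expect_add_distrib]
        ring
    _ ≤ (𝔼 a, (R a + R (σ a))) / 2 := by
        refine div_le_div_of_nonneg_right ?_ zero_le_two
        exact Finset.expect_le_expect fun a _ => contract a
    _ = 𝔼 a, R a := by
        rw [Finset.expect_add_distrib, hσR]
        ring

theorem expect_fin_succ {X : Type*} [Fintype X] {n : ℕ} (F : (Fin (n + 1) → X) → ℝ) :
    𝔼 a, F a = 𝔼 b : X, 𝔼 a : Fin n → X, F (Fin.cons b a) := by
  rw [← Finset.expect_product', Finset.univ_product_univ]
  exact (Fintype.expect_equiv (Fin.consEquiv fun _ => X) _ _ fun _ => rfl).symm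

theorem expect_iSup_sum_sub_abs_le {X ι : Type*} [Fintype X] [Nonempty X] [Finite ι] [Nonempty ι]
    (f : X → ι → ℝ) (σ : X ≃ X) (hσ : ∀ a t, f (σ a) t = -f a t) (n : ℕ) (G : ι → ℝ) :
    𝔼 a : Fin n → X, ⨆ t, (G t + ∑ i, ((𝔼 b, |f b t|) - |f (a i) t|)) ≤
      𝔼 a : Fin n → X, ⨆ t, (G t + ∑ i, 2 * f (a i) t) := by
  induction n generalizing G with
  | zero => simp
  | succ n ih =>
    rw [expect_fin_succ, expect_fin_succ]
    simp only [Fin.sum_univ_succ, Fin.cons_zero, Fin.cons_succ, ← add_assoc]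
    calc _ ≤ 𝔼 c : X, 𝔼 a : Fin n → X,
          ⨆ t, (G t + ((𝔼 b, |f b t|) - |f c t|) + ∑ i, 2 * f (a i) t) :=
        Finset.expect_le_expect fun c _ => ih _
      _ = 𝔼 a : Fin n → X, 𝔼 c : X,
          ⨆ t, (G t + (∑ i, 2 * f (a i) t) + ((𝔼 b, |f b t|) - |f c t|)) := by
        rw [Finset.expect_comm]
        simp only [add_right_comm]
      _ ≤ 𝔼 a : Fin n → X, 𝔼 c : X, ⨆ t, (G t + (∑ i, 2 * f (a i) t) + 2 * f c t) :=
        Finset.expect_le_expect fun a _ => expect_iSup_sub_abs_le f σ hσ _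
      _ = _ := by
        rw [Finset.expect_comm]
        simp only [add_right_comm]

/-- The Rademacher sum with signs `b` and coefficients `x`. -/
noncomputable def signSum {N : ℕ} (b : Fin N → ℤˣ) (x : Fin N → ℝ) : ℝ :=
  ∑ j, ((b j : ℤ) : ℝ) * x j

theorem signSum_neg {N : ℕ} (b : Fin N → ℤˣ) (x : Fin N → ℝ) :
    signSum (-b) x = -signSum b x := by
  simp [signSum]

theorem expect_units_int (F : ℤˣ → ℝ) : 𝔼 e, F e = (F 1 + F (-1)) / 2 := by
  rw [Fintype.expect_eq_sum_div_card, UnitsInt.univ]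
  rw [Finset.sum_pair (by decide)]
  simp

theorem expect_signSum_sq {N : ℕ} (x : Fin N → ℝ) : 𝔼 b, signSum b x ^ 2 = ∑ j, x j ^ 2 := by
  induction N with
  | zero => simp [signSum]
  | succ N ih =>
    rw [expect_fin_succ, expect_units_int, ← Finset.expect_add_distrib, Fin.sum_univ_succ,
      ← ih (fun j => x j.succ), Finset.expect_div]
    have h : ∀ a : Fin N → ℤˣ, (signSum (Fin.cons 1 a) x ^ 2 + signSum (Fin.cons (-1) a) x ^ 2) / 2
        = x 0 ^ 2 + signSum a (fun j => x j.succ) ^ 2 := by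
      intro a
      simp only [signSum, Fin.sum_univ_succ, Fin.cons_zero, Fin.cons_succ]
      push_cast
      ring
    simp only [h]
    rw [Finset.expect_add_distrib, Fintype.expect_const]

theorem expect_signSum_pow_four_le {N : ℕ} (x : Fin N → ℝ) :
    𝔼 b, signSum b x ^ 4 ≤ 3 * (∑ j, x j ^ 2) ^ 2 := by
  induction N with
  | zero => simp [signSum]
  | succ N ih =>
    have ih' := ih (fun j => x j.succ)
    rw [← expect_signSum_sq] at ih'
    rw [expect_fin_succ, expect_units_int, ← Finset.expect_add_distrib, Fin.sum_univ_succ,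
      ← expect_signSum_sq (fun j => x j.succ), Finset.expect_div]
    have h : ∀ a : Fin N → ℤˣ, (signSum (Fin.cons 1 a) x ^ 4 + signSum (Fin.cons (-1) a) x ^ 4) / 2
        = x 0 ^ 4 + 6 * x 0 ^ 2 * signSum a (fun j => x j.succ) ^ 2
          + signSum a (fun j => x j.succ) ^ 4 := by
      intro a
      simp only [signSum, Fin.sum_univ_succ, Fin.cons_zero, Fin.cons_succ]
      push_cast
      ring
    simp only [h]
    rw [Finset.expect_add_distrib, Finset.expect_add_distrib, Fintype.expect_const,
      ← Finset.mul_expect]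
    nlinarith [sq_nonneg (x 0 ^ 2)]

theorem expect_abs_signSum_ge {N : ℕ} (x : Fin N → ℝ) (hx : ∑ j, x j ^ 2 = 1) :
    1 / 4 ≤ 𝔼 b, |signSum b x| := by
  have pointwise : ∀ z : ℝ, z ^ 2 / 2 - z ^ 4 / 12 ≤ |z| := by
    intro z
    have h0 := abs_nonneg z
    rw [← sq_abs, ← Even.pow_abs (by decide : Even 4) z]
    generalize |z| = w at *
    nlinarith [mul_nonneg h0 (mul_nonneg (add_nonneg h0 h0) (sq_nonneg (w - 2))),
      mul_nonneg h0 (sq_nonneg (w - 2)), mul_nonneg h0 (mul_nonneg h0 (sq_nonneg (w - 3/2))),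
      mul_nonneg h0 (sq_nonneg (w - 3/2)), mul_nonneg h0 h0]
  have h2 := expect_signSum_sq x
  have h4 := expect_signSum_pow_four_le x
  rw [hx] at h2 h4
  calc (1 : ℝ) / 4 ≤ (𝔼 b, signSum b x ^ 2) / 2 - (𝔼 b, signSum b x ^ 4) / 12 := by
        rw [h2]; linarith
    _ = 𝔼 b, (signSum b x ^ 2 / 2 - signSum b x ^ 4 / 12) := by
        rw [Finset.expect_sub_distrib, Finset.expect_div, Finset.expect_div]
    _ ≤ _ := Finset.expect_le_expect fun b _ => pointwise _

theorem expect_exp_sum_le {N : ℕ} (j : Fin N) (l : ℝ) (m : ℕ) :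
    𝔼 a : Fin m → Fin N → ℤˣ, Real.exp (∑ i, l * ((a i j : ℤ) : ℝ)) ≤
      Real.exp (m * (l ^ 2 / 2)) := by
  have one : 𝔼 b : Fin N → ℤˣ, Real.exp (l * ((b j : ℤ) : ℝ)) ≤ Real.exp (l ^ 2 / 2) := by
    have hneg : 𝔼 b : Fin N → ℤˣ, Real.exp (l * (((-b) j : ℤˣ) : ℤ)) =
        𝔼 b : Fin N → ℤˣ, Real.exp (l * ((b j : ℤ) : ℝ)) :=
      Fintype.expect_equiv (Equiv.neg _) _ _ fun _ => rfl
    have hcosh : ∀ b : Fin N → ℤˣ,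
        Real.exp (l * ((b j : ℤ) : ℝ)) + Real.exp (l * (((-b) j : ℤˣ) : ℤ)) = 2 * Real.cosh l := by
      intro b
      rw [Real.cosh_eq]
      rcases Int.units_eq_one_or (b j) with h | h <;> simp [h] <;> ring
    have hsum : 2 * (𝔼 b : Fin N → ℤˣ, Real.exp (l * ((b j : ℤ) : ℝ))) = 2 * Real.cosh l := by
      nth_rw 1 [two_mul]
      nth_rw 2 [← hneg]
      rw [← Finset.expect_add_distrib]
      simp only [hcosh, Fintype.expect_const]
    linarith [Real.cosh_le_exp_half_sq l]
  induction m with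
  | zero => simp
  | succ m ih =>
    rw [expect_fin_succ]
    simp only [Fin.sum_univ_succ, Fin.cons_zero, Fin.cons_succ, Real.exp_add,
      ← Finset.mul_expect, ← Finset.expect_mul]
    push_cast
    rw [add_mul, add_comm, Real.exp_add, one_mul]
    gcongr

theorem rpow_le_rpow_mul_exp {Q t : ℝ} (hQ : 0 < Q) (ht : 0 ≤ t) :
    t ^ Q ≤ Q ^ Q * Real.exp t := by
  have h : t / Q ≤ Real.exp (t / Q) := by linarith [Real.add_one_le_exp (t / Q)]
  have h2 := Real.rpow_le_rpow (by positivity) h hQ.le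
  rw [← Real.exp_mul, Real.div_rpow ht hQ.le, div_mul_cancel₀ _ hQ.ne',
    div_le_iff₀ (by positivity)] at h2
  linarith

theorem expect_abs_rpow_le {N m : ℕ} (hm : 0 < m) (j : Fin N) {Q : ℝ} (hQ : 0 < Q) :
    𝔼 a : Fin m → Fin N → ℤˣ, |(∑ i, ((a i j : ℤ) : ℝ)) / √m| ^ Q ≤
      Q ^ Q * (2 * Real.exp (1 / 2)) := by
  have hm' : (0 : ℝ) < m := by exact_mod_cast hm
  have hs : (√(m : ℝ)) ^ 2 = m := Real.sq_sqrt hm'.le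
  have e1 := expect_exp_sum_le j (1 / √m) m
  have e2 := expect_exp_sum_le j (-(1 / √m)) m
  have hexp : (m : ℝ) * ((1 / √m) ^ 2 / 2) = 1 / 2 := by
    rw [div_pow, hs]; field_simp
  rw [neg_sq] at e2
  rw [hexp] at e1 e2
  calc _ ≤ 𝔼 a : Fin m → Fin N → ℤˣ, Q ^ Q * (Real.exp (∑ i, 1 / √m * ((a i j : ℤ) : ℝ)) +
          Real.exp (∑ i, -(1 / √m) * ((a i j : ℤ) : ℝ))) := by
        refine Finset.expect_le_expect fun a _ => ?_
        refine (rpow_le_rpow_mul_exp hQ (abs_nonneg _)).trans ?_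
        gcongr
        rw [← Finset.mul_sum, ← Finset.mul_sum, neg_mul, one_div_mul_eq_div]
        exact Real.exp_abs_le _
    _ ≤ _ := by
        rw [← Finset.mul_expect, Finset.expect_add_distrib]
        gcongr
        linarith

/-- Young's inequality, rescaled and summed. -/
theorem sum_mul_le_of_sum_rpow_le {N : ℕ} {Q q L κ : ℝ} (hQq : Q.HolderConjugate q) (hL : 0 < L)
    (hκ : 0 < κ) (u x : Fin N → ℝ) (hx : ∑ j, |x j| ^ q ≤ κ ^ q) :
    ∑ j, u j * x j ≤ L * κ * ((∑ j, |u j| ^ Q) / (L ^ Q * Q) + 1 / q) := by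
  have hQ := hQq.pos
  have hq := hQq.symm.pos
  have young : ∀ j, u j * x j ≤
      L * κ * (|u j| ^ Q / (L ^ Q * Q) + |x j| ^ q / (κ ^ q * q)) := by
    intro j
    have h := Real.young_inequality (u j / L) (x j / κ) hQq
    rw [abs_div, abs_div, abs_of_pos hL, abs_of_pos hκ, Real.div_rpow (abs_nonneg _) hL.le,
      Real.div_rpow (abs_nonneg _) hκ.le, div_div, div_div] at h
    calc u j * x j = L * κ * (u j / L * (x j / κ)) := by field_simp
      _ ≤ _ := by gcongr
  calc _ ≤ ∑ j, L * κ * (|u j| ^ Q / (L ^ Q * Q) + |x j| ^ q / (κ ^ q * q)) :=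
        Finset.sum_le_sum fun j _ => young j
    _ = L * κ * ((∑ j, |u j| ^ Q) / (L ^ Q * Q) + (∑ j, |x j| ^ q) / (κ ^ q * q)) := by
        rw [← Finset.mul_sum, Finset.sum_add_distrib, Finset.sum_div, Finset.sum_div]
    _ ≤ L * κ * ((∑ j, |u j| ^ Q) / (L ^ Q * Q) + κ ^ q / (κ ^ q * q)) := by gcongr
    _ = _ := by
        have : κ ^ q ≠ 0 := (Real.rpow_pos_of_pos hκ q).ne'
        field_simp

/-- If `L` dominates the `Q`-th moments of normalised Rademacher sums and `8 L κ < √m`, then some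
`m × N` sign matrix has no kernel vector that is normalised in `ℓ_2` and has `ℓ_q` norm at most
`κ`. -/
theorem exists_signs_forall_kernel {N m : ℕ} (hm : 0 < m) {Q q L κ : ℝ}
    (hQq : Q.HolderConjugate q) (hL : 0 < L) (hκ : 0 < κ)
    (hLQ : N * (Q ^ Q * (2 * Real.exp (1 / 2))) ≤ L ^ Q) (hsmall : 8 * (L * κ) < √m) :
    ∃ a : Fin m → Fin N → ℤˣ, ∀ x : Fin N → ℝ, (∀ i, signSum (a i) x = 0) → ∑ j, x j ^ 2 = 1 →
      κ ^ q < ∑ j, |x j| ^ q := by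
  by_contra! hcon
  choose x hker hnorm hq using hcon
  have hm' : (0 : ℝ) < m := by exact_mod_cast hm
  have hsm : 0 < √(m : ℝ) := Real.sqrt_pos.2 hm'
  have hQ := hQq.pos
  have lower : (m : ℝ) / 4 ≤ 𝔼 a : Fin m → Fin N → ℤˣ, ⨆ t, ((0 : ℝ) +
      ∑ i, ((𝔼 b, |signSum b (x t)|) - |signSum (a i) (x t)|)) := by
    rw [← Fintype.expect_const (ι := Fin m → Fin N → ℤˣ) ((m : ℝ) / 4)]
    refine Finset.expect_le_expect fun a _ => ?_
    refine le_trans ?_ (le_ciSup (Set.finite_range _).bddAbove a)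
    simp only [hker, abs_zero, sub_zero, zero_add, Finset.sum_const, Finset.card_univ,
      Fintype.card_fin, nsmul_eq_mul]
    have := expect_abs_signSum_ge (x a) (hnorm a)
    nlinarith
  have upper : ∀ a : Fin m → Fin N → ℤˣ, ⨆ t, ((0 : ℝ) + ∑ i, 2 * signSum (a i) (x t)) ≤
      2 * √m * (L * κ * ((∑ j, |(∑ i, ((a i j : ℤ) : ℝ)) / √m| ^ Q) / (L ^ Q * Q) + 1 / q)) := by
    intro a
    refine ciSup_le fun t => ?_
    have h := sum_mul_le_of_sum_rpow_le hQq hL hκ (fun j => (∑ i, ((a i j : ℤ) : ℝ)) / √m) (x t)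
      (hq t)
    calc _ = 2 * √m * ∑ j, (∑ i, ((a i j : ℤ) : ℝ)) / √m * x t j := by
          simp only [signSum, zero_add, ← Finset.mul_sum]
          rw [Finset.sum_comm, mul_assoc, Finset.mul_sum Finset.univ _ (√(m : ℝ))]
          congr 1
          refine Finset.sum_congr rfl fun j _ => ?_
          rw [← Finset.sum_mul]
          field_simp
      _ ≤ _ := by gcongr
  have moment : 𝔼 a : Fin m → Fin N → ℤˣ, ∑ j, |(∑ i, ((a i j : ℤ) : ℝ)) / √m| ^ Q ≤ L ^ Q := by
    rw [Finset.expect_sum_comm]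
    refine le_trans (Finset.sum_le_sum fun j _ => expect_abs_rpow_le hm j hQ) ?_
    simpa using hLQ
  have key : (m : ℝ) / 4 ≤ 2 * √m * (L * κ) := by
    calc (m : ℝ) / 4 ≤ _ := lower
      _ ≤ _ := expect_iSup_sum_sub_abs_le (fun b t => signSum b (x t)) (Equiv.neg _)
          (fun b t => signSum_neg b (x t)) m fun _ => 0
      _ ≤ _ := Finset.expect_le_expect fun a _ => upper a
      _ = 2 * √m * (L * κ * ((𝔼 a : Fin m → Fin N → ℤˣ,
          ∑ j, |(∑ i, ((a i j : ℤ) : ℝ)) / √m| ^ Q) / (L ^ Q * Q) + 1 / q)) := by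
          rw [← Finset.mul_expect, ← Finset.mul_expect, Finset.expect_add_distrib,
            Fintype.expect_const, Finset.expect_div]
      _ ≤ 2 * √m * (L * κ * (L ^ Q / (L ^ Q * Q) + 1 / q)) := by gcongr
      _ = 2 * √m * (L * κ) := by
          have h1 : L ^ Q / (L ^ Q * Q) = Q⁻¹ := by
            have : L ^ Q ≠ 0 := (Real.rpow_pos_of_pos hL Q).ne'
            field_simp
          rw [h1, one_div, hQq.inv_add_inv_eq_one, mul_one]
  nlinarith [Real.mul_self_sqrt hm'.le]

/-- Interpolation between `ℓ_p` and `ℓ_2` for vectors normalised in `ℓ_2`. -/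
theorem sum_rpow_le_of_sum_sq_eq_one {N : ℕ} {p a ρ : ℝ} (hp0 : 0 < p) (ha0 : 0 < a) (ha1 : a < 1)
    (hρ : 0 < ρ) (x : Fin N → ℝ) (h2 : ∑ j, x j ^ 2 = 1) (hp : ∑ j, |x j| ^ p ≤ ρ) :
    ∑ j, |x j| ^ (p * a + 2 * (1 - a)) ≤ ρ ^ a := by
  have hb : 0 < 1 - a := by linarith
  have pointwise : ∀ j, |x j| ^ (p * a + 2 * (1 - a)) ≤
      ρ ^ a * (a * (|x j| ^ p / ρ) + (1 - a) * x j ^ 2) := by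
    intro j
    have h := Real.geom_mean_le_arith_mean2_weighted ha0.le hb.le
      (by positivity : 0 ≤ |x j| ^ p / ρ) (sq_nonneg (x j)) (by ring)
    refine le_trans (le_of_eq ?_) (mul_le_mul_of_nonneg_left h (by positivity))
    rw [Real.div_rpow (by positivity) hρ.le, ← sq_abs (x j), ← Real.rpow_natCast,
      ← Real.rpow_mul (abs_nonneg _), ← Real.rpow_mul (abs_nonneg _),
      Real.rpow_add_of_nonneg (abs_nonneg _) (by positivity) (by positivity)]
    have : ρ ^ a ≠ 0 := (Real.rpow_pos_of_pos hρ a).ne'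
    push_cast
    field_simp
  calc _ ≤ ∑ j, ρ ^ a * (a * (|x j| ^ p / ρ) + (1 - a) * x j ^ 2) :=
        Finset.sum_le_sum fun j _ => pointwise j
    _ = ρ ^ a * (a * ((∑ j, |x j| ^ p) / ρ) + (1 - a)) := by
        rw [← Finset.mul_sum, Finset.sum_add_distrib, ← Finset.mul_sum, ← Finset.mul_sum,
          ← Finset.sum_div, h2, mul_one]
    _ ≤ ρ ^ a * (a * 1 + (1 - a)) := by
        gcongr
        exact (div_le_one hρ).2 hp
    _ = _ := by ring

theorem pNorm_nonneg (p : ℝ≥0∞) {N : ℕ} (x : Fin N → ℝ) : 0 ≤ pNorm p x := by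
  unfold pNorm
  split_ifs
  · exact Real.iSup_nonneg fun i => abs_nonneg _
  · positivity

theorem pNorm_le_sqrt_sum_sq {p : ℝ≥0∞} (hp : 2 < p) {N : ℕ} (x : Fin N → ℝ) :
    pNorm p x ≤ √(∑ j, x j ^ 2) := by
  have coord : ∀ i, |x i| ≤ √(∑ j, x j ^ 2) := fun i => by
    rw [← Real.sqrt_sq_eq_abs]
    exact Real.sqrt_le_sqrt
      (Finset.single_le_sum (f := fun j => x j ^ 2) (fun j _ => sq_nonneg _) (Finset.mem_univ i))
  unfold pNorm
  split_ifs with h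
  · exact Real.iSup_le coord (Real.sqrt_nonneg _)
  · have h2 : 2 < p.toReal := by
      simpa using (ENNReal.toReal_lt_toReal (by simp) h).2 hp
    have hsum0 : 0 ≤ ∑ j, x j ^ 2 := Finset.sum_nonneg fun j _ => sq_nonneg _
    set r := p.toReal
    set t := √(∑ j, x j ^ 2) with ht
    have ht0 : 0 ≤ t := Real.sqrt_nonneg _
    rw [one_div, Real.rpow_inv_le_iff_of_pos (by positivity) ht0 (by linarith)]
    calc ∑ i, |x i| ^ r ≤ ∑ i, t ^ (r - 2) * x i ^ 2 := by
          refine Finset.sum_le_sum fun i _ => ?_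
          have : |x i| ^ r = |x i| ^ (r - 2) * x i ^ 2 := by
            rw [← sq_abs (x i), ← Real.rpow_natCast, ← Real.rpow_add_of_nonneg (abs_nonneg _)
              (by linarith) (by norm_num)]
            norm_num
          rw [this]
          gcongr
          exact coord i
      _ = t ^ (r - 2) * t ^ 2 := by rw [← Finset.mul_sum, ht, Real.sq_sqrt hsum0]
      _ = t ^ r := by
          rw [← Real.rpow_natCast, ← Real.rpow_add_of_nonneg ht0 (by linarith) (by norm_num)]
          norm_num

theorem sum_rpow_le_one_of_pNorm_le_one {p : ℝ} (hp : 0 < p) {N : ℕ} {x : Fin N → ℝ}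
    (hx : pNorm (ENNReal.ofReal p) x ≤ 1) : ∑ j, |x j| ^ p ≤ 1 := by
  rw [pNorm, if_neg ENNReal.ofReal_ne_top, ENNReal.toReal_ofReal hp.le, one_div,
    Real.rpow_inv_le_iff_of_pos (by positivity) zero_le_one hp, Real.one_rpow] at hx
  exact hx

theorem sum_sq_le_one_of_sum_rpow_le_one {p : ℝ} (hp : 0 < p) (hp2 : p ≤ 2) {N : ℕ}
    {x : Fin N → ℝ} (hx : ∑ j, |x j| ^ p ≤ 1) : ∑ j, x j ^ 2 ≤ 1 := by
  refine le_trans (Finset.sum_le_sum fun j _ => ?_) hx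
  have h1 : |x j| ^ p ≤ 1 := le_trans
    (Finset.single_le_sum (f := fun j => |x j| ^ p) (fun j _ => by positivity)
      (Finset.mem_univ j)) hx
  have h2 : |x j| ≤ 1 := by
    by_contra! h
    exact absurd h1 (not_le.2 (Real.one_lt_rpow h hp))
  rw [← sq_abs, ← Real.rpow_natCast]
  exact Real.rpow_le_rpow_of_exponent_ge_of_imp (abs_nonneg _) h2 (by simpa using hp2)
    (fun _ h => absurd h (by norm_num))

theorem gelfandNumber_le {p q : ℝ≥0∞} {N n : ℕ} {B : ℝ} (hB : 0 ≤ B)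
    (M : Submodule ℝ (Fin N → ℝ)) (hM : N - Module.finrank ℝ M < n)
    (h : ∀ x ∈ M, pNorm p x ≤ 1 → pNorm q x ≤ B) : gelfandNumber p q N n ≤ B := by
  refine le_trans (csInf_le ⟨0, ?_⟩ ⟨M, hM, rfl⟩) (Real.sSup_le ?_ hB)
  · rintro _ ⟨M', _, rfl⟩
    refine Real.sSup_nonneg ?_
    rintro _ ⟨x, _, _, rfl⟩
    exact pNorm_nonneg _ _
  · rintro _ ⟨x, hx, hx1, rfl⟩
    exact h x hx hx1

/-- The linear map given by a matrix of signs. -/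
noncomputable def signMap {N m : ℕ} (a : Fin m → Fin N → ℤˣ) : (Fin N → ℝ) →ₗ[ℝ] (Fin m → ℝ) where
  toFun x i := signSum (a i) x
  map_add' x y := by
    ext i
    simp [signSum, mul_add, Finset.sum_add_distrib]
  map_smul' c x := by
    ext i
    simp [signSum, Finset.mul_sum, mul_left_comm]

theorem finrank_sub_finrank_ker_signMap_le {N m : ℕ} (a : Fin m → Fin N → ℤˣ) :
    N - Module.finrank ℝ (LinearMap.ker (signMap a)) ≤ m := by
  have h1 := LinearMap.finrank_range_add_finrank_ker (signMap a)
  have h2 := Submodule.finrank_le (LinearMap.range (signMap a))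
  simp only [Module.finrank_fintype_fun_eq_card, Fintype.card_fin] at h1 h2
  omega

/-- Rescaling: an `ℓ_p` lower bound on the unit sphere of `ℓ_2` in a subspace bounds the `ℓ_2` norm
on the unit ball of `ℓ_p`. -/
theorem sqrt_sum_sq_le_of_forall_sphere {N : ℕ} {p ρ : ℝ} (hp : 0 < p) (hρ : 0 < ρ)
    (M : Submodule ℝ (Fin N → ℝ))
    (hM : ∀ x ∈ M, ∑ j, x j ^ 2 = 1 → ρ ^ p ≤ ∑ j, |x j| ^ p)
    {x : Fin N → ℝ} (hx : x ∈ M) (hx1 : ∑ j, |x j| ^ p ≤ 1) : √(∑ j, x j ^ 2) ≤ ρ⁻¹ := by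
  have hsum0 : 0 ≤ ∑ j, x j ^ 2 := Finset.sum_nonneg fun j _ => sq_nonneg _
  have hsq := Real.sq_sqrt hsum0
  have ht0 := Real.sqrt_nonneg (∑ j, x j ^ 2)
  generalize √(∑ j, x j ^ 2) = t at hsq ht0 ⊢
  rcases ht0.eq_or_lt with rfl | h0
  · positivity
  have h := hM (t⁻¹ • x) (M.smul_mem _ hx) (by
    simp only [Pi.smul_apply, smul_eq_mul, mul_pow, ← Finset.mul_sum]
    rw [← hsq]
    field_simp)
  simp only [Pi.smul_apply, smul_eq_mul, abs_mul, abs_inv, abs_of_pos h0] at h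
  simp only [Real.mul_rpow (inv_nonneg.2 h0.le) (abs_nonneg _), ← Finset.mul_sum] at h
  have h3 : ρ ^ p ≤ t⁻¹ ^ p := h.trans (mul_le_of_le_one_right (by positivity) hx1)
  rw [Real.rpow_le_rpow_iff hρ.le (by positivity) hp] at h3
  exact (le_inv_comm₀ hρ h0).1 h3

theorem gelfandNumber_succ_le {p α β : ℝ} {p₂ : ℝ≥0∞} (hp : 0 < p) (hp1 : p ≤ 1) (hp₂ : 2 < p₂)
    (hα : α = 1 / p - 1 / 2) (hαβ : α < β) {N m : ℕ} (hN : 0 < N) (hm : 0 < m) :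
    gelfandNumber (ENNReal.ofReal p) p₂ N (m + 1) ≤
      (16 ^ (2 * β) * ((2 * β / (β - α)) ^ (2 * β / (β - α)) * (2 * Real.exp (1 / 2))) ^ (β - α)) *
        (N : ℝ) ^ (β - α) * (m : ℝ) ^ (-β) := by
  have hm' : (0 : ℝ) < m := by exact_mod_cast hm
  have hN' : (0 : ℝ) < N := by exact_mod_cast hN
  have hα2 : 1 / 2 ≤ α := by
    have : 1 ≤ 1 / p := (one_le_div hp).2 hp1
    linarith
  have hβ : 0 < β := by linarith
  have hγ : 0 < β - α := by linarith
  have hδ : 0 < β + α := by linarith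
  have hpα : p * α = 1 - p / 2 := by
    rw [hα]
    field_simp
  set Q := 2 * β / (β - α) with hQdef
  set q := 2 * β / (β + α) with hqdef
  have hQ : 0 < Q := by positivity
  have hq : 0 < q := by positivity
  have hQq : Q.HolderConjugate q := by
    rw [Real.holderConjugate_iff]
    constructor
    · rw [hQdef, lt_div_iff₀ hγ]
      linarith
    · rw [hQdef, hqdef]
      field_simp
      ring
  set C := Q ^ Q * (2 * Real.exp (1 / 2)) with hC
  have hC0 : 0 < C := by positivity
  set L := (N * C) ^ Q⁻¹ with hL
  have hL0 : 0 < L := by positivity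
  set κ := √m / (16 * L) with hκ
  have hsm : 0 < √(m : ℝ) := Real.sqrt_pos.2 hm'
  have hκ0 : 0 < κ := by positivity
  obtain ⟨a, ha⟩ := exists_signs_forall_kernel (N := N) hm hQq hL0 hκ0
    (by rw [hL, Real.rpow_inv_rpow (by positivity) hQ.ne'])
    (by
      have : 8 * (L * κ) = √m / 2 := by
        rw [hκ]
        field_simp
        norm_num
      rw [this]
      linarith)
  set ρ := κ ^ (2 * β) with hρ
  have hρ0 : 0 < ρ := by positivity
  set θ := (p * (β + α))⁻¹ with hθ
  have hθ0 : 0 < θ := by positivity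
  have hθ1 : θ < 1 := by
    refine inv_lt_one_of_one_lt₀ ?_
    nlinarith
  have hqθ : p * θ + 2 * (1 - θ) = q := by
    rw [hθ, hqdef]
    field_simp
    linear_combination 2 * hpα
  have hbound : ρ⁻¹ = 16 ^ (2 * β) * C ^ (β - α) * (N : ℝ) ^ (β - α) * (m : ℝ) ^ (-β) := by
    have hexp : Q⁻¹ * (2 * β) = β - α := by
      rw [hQdef]
      field_simp
    rw [hρ, hκ, ← Real.inv_rpow (by positivity), inv_div, Real.div_rpow (by positivity) hsm.le,
      Real.mul_rpow (by norm_num) hL0.le, hL, ← Real.rpow_mul (by positivity), hexp,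
      Real.mul_rpow hN'.le hC0.le, Real.sqrt_eq_rpow, ← Real.rpow_mul hm'.le,
      Real.rpow_neg hm'.le, show 1 / 2 * (2 * β) = β by ring]
    ring
  rw [← hbound]
  refine gelfandNumber_le (by positivity) (LinearMap.ker (signMap a))
    (Nat.lt_succ_of_le (finrank_sub_finrank_ker_signMap_le a)) fun x hx hx1 => ?_
  refine (pNorm_le_sqrt_sum_sq hp₂ x).trans ?_
  refine sqrt_sum_sq_le_of_forall_sphere hp hρ0 _ (fun y hy hy2 => ?_) hx
    (sum_rpow_le_one_of_pNorm_le_one hp hx1)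
  by_contra! hcon
  have h1 := sum_rpow_le_of_sum_sq_eq_one hp hθ0 hθ1 (by positivity) y hy2 hcon.le
  have h2 := ha y (fun i => congrFun (LinearMap.mem_ker.1 hy) i) hy2
  have h3 : 2 * β * p * θ = q := by
    rw [hθ, hqdef]
    field_simp
  rw [hqθ, hρ, ← Real.rpow_mul hκ0.le, ← Real.rpow_mul hκ0.le, h3] at h1
  linarith

/-- For `0 < p₁ ≤ 1`, `2 < p₂ ≤ ∞` and `1/s > 1/p₁ - 1/2` there is `C > 0` with
`sup_n n^{1/s}·c_n(id : ℓ_{p₁}^N → ℓ_{p₂}^N) ≤ C·N^{1/s - (1/p₁ - 1/2)}` for every `N`. -/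
theorem gelfand_ideal_norm (p₁ s : ℝ) (p₂ : ℝ≥0∞) (h1 : 0 < p₁) (h2 : p₁ ≤ 1)
    (h3 : 2 < p₂) (hs : 0 < s) (hs2 : 1/p₁ - 1/2 < 1/s) :
    ∃ C : ℝ, 0 < C ∧ ∀ N n : ℕ, 1 ≤ n →
      (n : ℝ) ^ (1/s) * gelfandNumber (ENNReal.ofReal p₁) p₂ N n ≤
        C * (N : ℝ) ^ (1/s - (1/p₁ - 1/2)) := by
  have hs' : 0 < 1 / s := by positivity
  set β := 1 / s with hβ
  obtain ⟨α, hα⟩ : ∃ α, α = 1 / p₁ - 1 / 2 := ⟨_, rfl⟩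
  rw [← hα] at hs2 ⊢
  set K : ℝ := 16 ^ (2 * β) *
    ((2 * β / (β - α)) ^ (2 * β / (β - α)) * (2 * Real.exp (1 / 2))) ^ (β - α) with hK
  have hγ : 0 < β - α := by linarith
  have hK0 : 0 < K := by positivity
  refine ⟨2 ^ β * K + 1, by positivity, fun N n hn => ?_⟩
  rcases lt_or_ge N n with hNn | hNn
  · have h0 : gelfandNumber (ENNReal.ofReal p₁) p₂ N n ≤ 0 := by
      refine gelfandNumber_le le_rfl ⊥ (by simpa using hNn) fun x hx _ => ?_
      rw [(Submodule.mem_bot ℝ).1 hx]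
      simpa using pNorm_le_sqrt_sum_sq h3 (0 : Fin N → ℝ)
    exact (mul_nonpos_of_nonneg_of_nonpos (by positivity) h0).trans (by positivity)
  have hN : 0 < N := by omega
  have hN1 : 1 ≤ (N : ℝ) ^ (β - α) := Real.one_le_rpow (by exact_mod_cast hN) hγ.le
  obtain ⟨m, rfl⟩ : ∃ m, n = m + 1 := ⟨n - 1, by omega⟩
  rcases Nat.eq_zero_or_pos m with rfl | hm
  · have h0 : gelfandNumber (ENNReal.ofReal p₁) p₂ N (0 + 1) ≤ 1 := by
      refine gelfandNumber_le zero_le_one ⊤ (by simp) fun x _ hx => ?_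
      refine (pNorm_le_sqrt_sum_sq h3 x).trans (Real.sqrt_le_one.2 ?_)
      exact sum_sq_le_one_of_sum_rpow_le_one h1 (by linarith)
        (sum_rpow_le_one_of_pNorm_le_one h1 hx)
    have hC : 1 ≤ 2 ^ β * K + 1 := le_add_of_nonneg_left (by positivity)
    simp only [zero_add, Nat.cast_one, Real.one_rpow, one_mul] at h0 ⊢
    nlinarith
  · have hm' : (0 : ℝ) < m := by exact_mod_cast hm
    have hgel := gelfandNumber_succ_le h1 h2 h3 hα hs2 hN hm
    have hpow : ((m + 1 : ℕ) : ℝ) ^ β ≤ 2 ^ β * (m : ℝ) ^ β := by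
      rw [← Real.mul_rpow zero_le_two hm'.le]
      refine Real.rpow_le_rpow (by positivity) ?_ hs'.le
      have : (1 : ℝ) ≤ m := by exact_mod_cast hm
      push_cast
      linarith
    calc _ ≤ ((m + 1 : ℕ) : ℝ) ^ β * (K * (N : ℝ) ^ (β - α) * (m : ℝ) ^ (-β)) := by gcongr
      _ ≤ 2 ^ β * (m : ℝ) ^ β * (K * (N : ℝ) ^ (β - α) * (m : ℝ) ^ (-β)) := by gcongr
      _ = 2 ^ β * K * (N : ℝ) ^ (β - α) := by
          rw [Real.rpow_neg hm'.le]
          have : (m : ℝ) ^ β ≠ 0 := (Real.rpow_pos_of_pos hm' β).ne'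
          field_simp
      _ ≤ _ := by
          gcongr
          linarith
end
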